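/- Let X be a GC_5 set of 21 nodes with no maximal line. Then the m-distribution sequence of every node of X is one of the following five sequences: (5,5,5,3,2), (5,5,4,4,2), (5,5,4,3,3), (5,4,4,4,3), (4,4,4,4,4). -/

import Mathlib

open MvPolynomial

/-- Evaluation of a bivariate polynomial at a point of the real plane. -/
noncomputable def ev (p : MvPolynomial (Fin 2) ℝ) (A : ℝ × ℝ) : ℝ :=
  MvPolynomial.eval ![A.1, A.2] p

/-- A polynomial of total degree exactly 1, defining a line. -/
def IsLinePoly (l : MvPolynomial (Fin 2) ℝ) : Prop := l.totalDegree = 1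

/-- The line (zero set) defined by a polynomial. -/
def lineSet (l : MvPolynomial (Fin 2) ℝ) : Set (ℝ × ℝ) := {A | ev l A = 0}

/-- The number of nodes of `X` lying on the line defined by `l`. -/
noncomputable def nodesOn (X : Set (ℝ × ℝ)) (l : MvPolynomial (Fin 2) ℝ) : ℕ :=
  (X ∩ lineSet l).ncard

/-- `X` is an `n`-poised set: it has `N = (n+2)(n+1)/2` nodes and the only polynomial of
degree ≤ n vanishing on all of `X` is the zero polynomial. -/
def Poised (n : ℕ) (X : Set (ℝ × ℝ)) : Prop :=
  X.Finite ∧ X.ncard = (n + 2) * (n + 1) / 2 ∧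
    ∀ p : MvPolynomial (Fin 2) ℝ, p.totalDegree ≤ n → (∀ A ∈ X, ev p A = 0) → p = 0

/-- `p` is an `n`-fundamental polynomial of the node `A` with respect to `X`. -/
def IsFund (n : ℕ) (X : Set (ℝ × ℝ)) (A : ℝ × ℝ) (p : MvPolynomial (Fin 2) ℝ) : Prop :=
  p.totalDegree ≤ n ∧ ev p A = 1 ∧ ∀ B ∈ X, B ≠ A → ev p B = 0

/-- `X` is a `GC_n` set: it is `n`-poised and each fundamental polynomial is a product of
`n` linear (degree-1) polynomials. -/
def GCSet (n : ℕ) (X : Set (ℝ × ℝ)) : Prop :=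
  Poised n X ∧ ∀ A ∈ X, ∃ p : MvPolynomial (Fin 2) ℝ, IsFund n X A p ∧
    ∃ f : Fin n → MvPolynomial (Fin 2) ℝ, (∀ i, IsLinePoly (f i)) ∧ p = ∏ i, f i

/-- The node `A` uses the line `l`: the linear polynomial `l` divides a fundamental
polynomial of `A`. -/
def Uses (n : ℕ) (X : Set (ℝ × ℝ)) (A : ℝ × ℝ) (l : MvPolynomial (Fin 2) ℝ) : Prop :=
  ∃ p, IsFund n X A p ∧ l ∣ p

/-- `X` has no maximal line, i.e. no line passes through `n+1` nodes of `X`. -/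
def NoMaximalLine (n : ℕ) (X : Set (ℝ × ℝ)) : Prop :=
  ∀ l : MvPolynomial (Fin 2) ℝ, IsLinePoly l → nodesOn X l ≠ n + 1

/-- Number of nodes of `X` on the line `l` which do not lie on any of the lines
`L 0, …, L (s-1)` (the primary node count of `l` at step `s`). -/
noncomputable def resCount (X : Set (ℝ × ℝ)) (L : Fin 5 → MvPolynomial (Fin 2) ℝ)
    (s : Fin 5) (l : MvPolynomial (Fin 2) ℝ) : ℕ :=
  {B ∈ X | ev l B = 0 ∧ ∀ i : Fin 5, i < s → ev (L i) B ≠ 0}.ncard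

/-- `L` is an m-line sequence of the node `A` of the `GC_5` set `X`: it enumerates the five
distinct used lines of `A` (a fundamental polynomial of `A` is, up to a constant, the
product of the `L i`), ordered greedily: at each step `s` the line `L s` has maximal
primary node count among the remaining used lines. -/
def MLineSeq (X : Set (ℝ × ℝ)) (A : ℝ × ℝ) (L : Fin 5 → MvPolynomial (Fin 2) ℝ) : Prop :=
  (∀ i, IsLinePoly (L i)) ∧
  (∀ i j : Fin 5, i ≠ j → lineSet (L i) ≠ lineSet (L j)) ∧
  (∃ p : MvPolynomial (Fin 2) ℝ, IsFund 5 X A p ∧ ∃ c : ℝ, p = MvPolynomial.C c * ∏ i, L i) ∧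
  (∀ s t : Fin 5, s ≤ t → resCount X L s (L t) ≤ resCount X L s (L s))

/-- The node `A` has m-distribution sequence `k`. -/
def HasMDSeq (X : Set (ℝ × ℝ)) (A : ℝ × ℝ) (k : Fin 5 → ℕ) : Prop :=
  ∃ L : Fin 5 → MvPolynomial (Fin 2) ℝ, MLineSeq X A L ∧ ∀ s, resCount X L s (L s) = k s

theorem ev_mul (p q : MvPolynomial (Fin 2) ℝ) (A : ℝ × ℝ) : ev (p * q) A = ev p A * ev q A :=
  map_mul _ p q

theorem ev_prod {ι : Type*} (s : Finset ι) (f : ι → MvPolynomial (Fin 2) ℝ) (A : ℝ × ℝ) :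
    ev (∏ i ∈ s, f i) A = ∏ i ∈ s, ev (f i) A :=
  map_prod _ f s

theorem IsLinePoly.ne_zero {l : MvPolynomial (Fin 2) ℝ} (hl : IsLinePoly l) : l ≠ 0 := by
  rintro rfl
  simp [IsLinePoly] at hl

/-- A bivariate polynomial of degree at most one is affine. -/
theorem eq_affine_of_totalDegree_le_one {l : MvPolynomial (Fin 2) ℝ} (hl : l.totalDegree ≤ 1) :
    ∃ a b c : ℝ, l = C a * X 0 + C b * X 1 + C c := by
  refine ⟨l.coeff (Finsupp.single 0 1), l.coeff (Finsupp.single 1 1), l.coeff 0, ?_⟩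
  ext d
  have hd : d = Finsupp.single 0 (d 0) + Finsupp.single 1 (d 1) := by
    ext i
    fin_cases i <;> simp
  by_cases h : 1 < d 0 + d 1
  · have hz : l.coeff d = 0 := by
      apply coeff_eq_zero_of_totalDegree_lt
      have hsum := Finsupp.sum_fintype d (fun _ e => e) (fun _ => rfl)
      rw [Finsupp.sum, Fin.sum_univ_two] at hsum
      omega
    have h0 : d ≠ 0 := by rintro rfl; simp at h
    have h1 : d ≠ Finsupp.single 0 1 := by rintro rfl; simp at h
    have h2 : d ≠ Finsupp.single 1 1 := by rintro rfl; simp at h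
    simp [hz, coeff_C_mul, coeff_X, coeff_C, h0.symm, h1.symm, h2.symm]
  · have h01 : (Finsupp.single 0 1 : Fin 2 →₀ ℕ) ≠ Finsupp.single 1 1 := by
      intro h; simpa using DFunLike.congr_fun h 0
    have h00 (i : Fin 2) : (0 : Fin 2 →₀ ℕ) ≠ Finsupp.single i 1 := by
      intro h; simpa using DFunLike.congr_fun h i
    have : d = 0 ∨ d = Finsupp.single 0 1 ∨ d = Finsupp.single 1 1 := by
      have : (d 0 = 0 ∧ d 1 = 0) ∨ (d 0 = 1 ∧ d 1 = 0) ∨ (d 0 = 0 ∧ d 1 = 1) := by omega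
      rcases this with ⟨h0, h1⟩ | ⟨h0, h1⟩ | ⟨h0, h1⟩ <;> rw [h0, h1] at hd <;> simp [hd]
    rcases this with rfl | rfl | rfl <;>
      simp [coeff_C_mul, coeff_X, coeff_C, h00, h01, h01.symm]

theorem IsLinePoly.exists_ev_eq {l : MvPolynomial (Fin 2) ℝ} (hl : IsLinePoly l) :
    ∃ a b c : ℝ, (a ≠ 0 ∨ b ≠ 0) ∧ ∀ A : ℝ × ℝ, ev l A = a * A.1 + b * A.2 + c := by
  obtain ⟨a, b, c, h⟩ := eq_affine_of_totalDegree_le_one hl.le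
  refine ⟨a, b, c, ?_, fun A => by simp [h, ev]⟩
  by_contra! hab
  rw [IsLinePoly, h, hab.1, hab.2] at hl
  simp at hl

/-- If two lines share two distinct points then the first is contained in the second. -/
theorem ev_eq_zero_of_two_common_points {l m : MvPolynomial (Fin 2) ℝ} (hl : IsLinePoly l)
    (hm : IsLinePoly m) {P Q R : ℝ × ℝ} (hPQ : P ≠ Q) (hlP : ev l P = 0) (hlQ : ev l Q = 0)
    (hmP : ev m P = 0) (hmQ : ev m Q = 0) (hlR : ev l R = 0) : ev m R = 0 := by
  obtain ⟨a, b, c, hab, h⟩ := hl.exists_ev_eq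
  obtain ⟨a', b', c', -, h'⟩ := hm.exists_ev_eq
  rw [h] at hlP hlQ hlR
  rw [h'] at hmP hmQ ⊢
  have hdet : a * b' = a' * b := by
    by_contra hne
    refine hPQ (Prod.ext ?_ ?_) <;> apply mul_left_cancel₀ (sub_ne_zero.mpr hne)
    · linear_combination b' * (hlP - hlQ) - b * (hmP - hmQ)
    · linear_combination a * (hmP - hmQ) - a' * (hlP - hlQ)
  rcases hab with ha | hb
  · apply mul_left_cancel₀ ha
    linear_combination a' * (hlR - hlP) + a * hmP + (R.2 - P.2) * hdet
  · apply mul_left_cancel₀ hb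
    linear_combination b' * (hlR - hlP) + b * hmP - (R.1 - P.1) * hdet

/-- Through any two distinct points there is the zero set of a nonzero polynomial of degree at
most one. -/
theorem exists_totalDegree_le_one_through {A B : ℝ × ℝ} (hAB : B ≠ A) :
    ∃ m : MvPolynomial (Fin 2) ℝ, m ≠ 0 ∧ m.totalDegree ≤ 1 ∧ ev m A = 0 ∧ ev m B = 0 := by
  refine ⟨C (B.2 - A.2) * (X 0 - C A.1) - C (B.1 - A.1) * (X 1 - C A.2), ?_, ?_, ?_, ?_⟩
  · intro h
    have h1 := congrArg (fun p => ev p (A.1 + (B.2 - A.2), A.2 - (B.1 - A.1))) h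
    simp [ev] at h1
    refine hAB (Prod.ext ?_ ?_) <;> nlinarith [sq_nonneg (B.2 - A.2), sq_nonneg (B.1 - A.1)]
  · have key (a c : ℝ) (i : Fin 2) :
        (C a * (X i - C c) : MvPolynomial (Fin 2) ℝ).totalDegree ≤ 1 := by
      refine (totalDegree_mul _ _).trans ?_
      rw [totalDegree_C, zero_add]
      exact (totalDegree_sub_C_le _ _).trans (totalDegree_X i).le
    exact (totalDegree_sub _ _).trans (max_le (key _ _ _) (key _ _ _))
  · simp [ev]
  · simp only [ev, map_sub, map_mul, eval_C, eval_X, Matrix.cons_val_zero, Matrix.cons_val_one]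
    ring

/-- A line contains at most `n + 1` nodes of a `GC_n` set. -/
theorem GCSet.nodesOn_le {n : ℕ} {X : Set (ℝ × ℝ)} (hX : GCSet n X)
    {l : MvPolynomial (Fin 2) ℝ} (hl : IsLinePoly l) : nodesOn X l ≤ n + 1 := by
  classical
  by_contra! hlt
  have hfin : (X ∩ lineSet l).Finite := hX.1.1.inter_of_left _
  rw [nodesOn, Set.ncard_eq_toFinset_card _ hfin] at hlt
  obtain ⟨B, hB⟩ : hfin.toFinset.Nonempty := Finset.card_pos.mp (by omega)
  have hB' : B ∈ X ∩ lineSet l := by simpa using hB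
  obtain ⟨p, ⟨-, hpB, hp⟩, f, hf, rfl⟩ := hX.2 B hB'.1
  have hcov : ∀ P ∈ hfin.toFinset.erase B, ∃ i, ev (f i) P = 0 := by
    intro P hP
    simp only [Finset.mem_erase, Set.Finite.mem_toFinset] at hP
    have := hp P hP.2.1 hP.1
    rw [ev_prod, Finset.prod_eq_zero_iff] at this
    simpa using this
  have hcard : n < (hfin.toFinset.erase B).card := by
    rw [Finset.card_erase_of_mem hB]
    omega
  obtain ⟨P₀, hP₀⟩ : (hfin.toFinset.erase B).Nonempty := Finset.card_pos.mp (by omega)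
  have : Nonempty (Fin n) := (hcov P₀ hP₀).nonempty
  choose! g hg using hcov
  obtain ⟨P, hP, Q, hQ, hPQ, hgPQ⟩ :=
    Finset.exists_ne_map_eq_of_card_lt_of_maps_to (s := hfin.toFinset.erase B)
      (t := (Finset.univ : Finset (Fin n))) (f := g)
      (by rwa [Finset.card_univ, Fintype.card_fin])
      (fun _ _ => Finset.mem_coe.mpr (Finset.mem_univ _))
  have hgP := hg P hP
  have hgQ := hg Q hQ
  simp only [Finset.mem_erase, Set.Finite.mem_toFinset] at hP hQ
  rw [← hgPQ] at hgQ
  have h0 : ev (f (g P)) B = 0 :=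
    ev_eq_zero_of_two_common_points hl (hf _) hPQ hP.2.2 hQ.2.2 hgP hgQ hB'.2
  rw [ev_prod, Finset.prod_eq_zero (Finset.mem_univ (g P)) h0] at hpB
  exact zero_ne_one hpB

theorem resCount_anti {X : Set (ℝ × ℝ)} (hX : X.Finite) (L : Fin 5 → MvPolynomial (Fin 2) ℝ)
    {s t : Fin 5} (hst : s ≤ t) (l : MvPolynomial (Fin 2) ℝ) :
    resCount X L t l ≤ resCount X L s l :=
  Set.ncard_le_ncard (fun _ hB => ⟨hB.1, hB.2.1, fun i hi => hB.2.2 i (hi.trans_le hst)⟩)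
    (hX.subset (Set.sep_subset _ _))

/-- The primary node counts of lines that cover exactly `X \ {A}` add up to `#X - 1`. -/
theorem sum_resCount_add_one {X : Set (ℝ × ℝ)} (hX : X.Finite)
    {L : Fin 5 → MvPolynomial (Fin 2) ℝ} {A : ℝ × ℝ} (hA : A ∈ X)
    (hLA : ∀ i, ev (L i) A ≠ 0) (hL : ∀ B ∈ X, B ≠ A → ∃ i, ev (L i) B = 0) :
    ∑ s, resCount X L s (L s) + 1 = X.ncard := by
  classical
  let F : Fin 5 → Set (ℝ × ℝ) := fun s =>
    {B ∈ X | ev (L s) B = 0 ∧ ∀ i : Fin 5, i < s → ev (L i) B ≠ 0}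
  have hF : ∀ s, (F s).Finite := fun s => hX.subset (Set.sep_subset _ _)
  have hunion : hX.toFinset.erase A = Finset.univ.biUnion fun s => (hF s).toFinset := by
    ext B
    simp only [Finset.mem_erase, Set.Finite.mem_toFinset, Finset.mem_biUnion, Finset.mem_univ,
      true_and]
    constructor
    · rintro ⟨hBA, hB⟩
      have hex := hL B hB hBA
      exact ⟨Fin.find _ hex, hB, Fin.find_spec hex, fun i hi => Fin.find_min hex hi⟩
    · rintro ⟨s, hB, hs, -⟩
      exact ⟨by rintro rfl; exact hLA s hs, hB⟩
  have hdisj : ((Finset.univ : Finset (Fin 5)) : Set (Fin 5)).PairwiseDisjoint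
      fun s => (hF s).toFinset := by
    intro s _ t _ hst
    simp only [Function.onFun, Finset.disjoint_left, Set.Finite.mem_toFinset]
    rintro B ⟨-, hs, hs'⟩ ⟨-, ht, ht'⟩
    rcases lt_or_gt_of_ne hst with h | h
    · exact ht' s h hs
    · exact hs' t h ht
  have hcard := congrArg Finset.card hunion
  rw [Finset.card_biUnion fun s hs t ht hst => hdisj hs ht hst] at hcard
  rw [Set.ncard_eq_toFinset_card X hX,
    ← Finset.card_erase_add_one (hX.mem_toFinset.mpr hA), hcard]
  congr 1
  exact Finset.sum_congr rfl fun s _ => Set.ncard_eq_toFinset_card _ (hF s)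

/-- The last primary node count is at least two: otherwise the first four lines, together with a
line through `A` and the remaining node, would contain a poised set. -/
theorem Poised.two_le_resCount_last {X : Set (ℝ × ℝ)} (hX : Poised 5 X)
    {L : Fin 5 → MvPolynomial (Fin 2) ℝ} (hline : ∀ i, IsLinePoly (L i)) {A : ℝ × ℝ}
    (hLA : ∀ i, ev (L i) A ≠ 0) (hL : ∀ B ∈ X, B ≠ A → ∃ i, ev (L i) B = 0) :
    2 ≤ resCount X L 4 (L 4) := by
  by_contra! hlt
  have hfin : {B ∈ X | ev (L 4) B = 0 ∧ ∀ i : Fin 5, i < 4 → ev (L i) B ≠ 0}.Finite :=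
    hX.1.subset (Set.sep_subset _ _)
  obtain ⟨B₀, hne, hB₀⟩ : ∃ B₀ : ℝ × ℝ, B₀ ≠ A ∧ ∀ B ∈ X, ev (L 4) B = 0 →
      (∀ i : Fin 5, i < 4 → ev (L i) B ≠ 0) → B = B₀ := by
    have h1 := (Set.ncard_le_one hfin).mp (Nat.lt_succ_iff.mp hlt)
    by_cases h : ∃ B ∈ X, ev (L 4) B = 0 ∧ ∀ i : Fin 5, i < 4 → ev (L i) B ≠ 0
    · obtain ⟨B₀, hB₀⟩ := h
      exact ⟨B₀, by rintro rfl; exact hLA 4 hB₀.2.1,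
        fun B hB h4 hlt4 => h1 B ⟨hB, h4, hlt4⟩ B₀ hB₀⟩
    · obtain ⟨B₀, hB₀⟩ := exists_ne A
      exact ⟨B₀, hB₀, fun B hB h4 hlt4 => absurd ⟨B, hB, h4, hlt4⟩ h⟩
  obtain ⟨m, hm0, hmdeg, hmA, hmB⟩ := exists_totalDegree_le_one_through hne
  have hprod : m * ∏ i ∈ Finset.Iio (4 : Fin 5), L i = 0 := by
    refine hX.2.2 _ ?_ fun B hB => ?_
    · refine (totalDegree_mul _ _).trans ?_
      have h4 : (∏ i ∈ Finset.Iio (4 : Fin 5), L i).totalDegree ≤ 4 :=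
        (totalDegree_finsetProd _ L).trans (by simp [Finset.sum_congr rfl fun i _ => hline i])
      omega
    · rw [ev_mul, ev_prod, mul_eq_zero, Finset.prod_eq_zero_iff]
      by_cases h : ∃ i : Fin 5, i < 4 ∧ ev (L i) B = 0
      · exact Or.inr (by simpa using h)
      · left
        push Not at h
        by_cases hBA : B = A
        · rwa [hBA]
        · obtain ⟨i, hi⟩ := hL B hB hBA
          have hi4 : i = 4 := by
            by_contra hi4
            exact h i (lt_of_le_of_ne (Fin.le_last i) hi4) hi
          rwa [hB₀ B hB (hi4 ▸ hi) h]
  exact mul_ne_zero hm0 (Finset.prod_ne_zero_iff.mpr fun i _ => (hline i).ne_zero) hprod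

/-- in a `GC_5` set with no maximal line, the m-distribution sequence of
every node is one of the five listed sequences. -/
theorem md_sequence_cases (X : Set (ℝ × ℝ)) (hX : GCSet 5 X) (hnm : NoMaximalLine 5 X)
    (A : ℝ × ℝ) (hA : A ∈ X) (k : Fin 5 → ℕ) (hk : HasMDSeq X A k) :
    k = ![5, 5, 5, 3, 2] ∨ k = ![5, 5, 4, 4, 2] ∨ k = ![5, 5, 4, 3, 3] ∨
      k = ![5, 4, 4, 4, 3] ∨ k = ![4, 4, 4, 4, 4] := by
  obtain ⟨L, ⟨hline, -, ⟨p, ⟨-, hpA, hp⟩, c, rfl⟩, hmax⟩, hk⟩ := hk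
  have hLA : ∀ i, ev (L i) A ≠ 0 := by
    intro i hi
    rw [ev_mul, ev_prod, Finset.prod_eq_zero (Finset.mem_univ i) hi, mul_zero] at hpA
    exact zero_ne_one hpA
  have hL : ∀ B ∈ X, B ≠ A → ∃ i, ev (L i) B = 0 := by
    intro B hB hBA
    have hc : ev (C c) B ≠ 0 := by
      intro hc
      rw [ev_mul, show ev (C c) A = ev (C c) B by simp [ev], hc, zero_mul] at hpA
      exact zero_ne_one hpA
    have := hp B hB hBA
    rw [ev_mul, ev_prod, mul_eq_zero, or_iff_right hc, Finset.prod_eq_zero_iff] at this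
    simpa using this
  have hanti : ∀ s t : Fin 5, s ≤ t → k t ≤ k s := fun s t hst => by
    rw [← hk, ← hk]
    exact (resCount_anti hX.1.1 L hst _).trans (hmax s t hst)
  have hsum := sum_resCount_add_one hX.1.1 hA hLA hL
  simp only [hX.1.2.1, hk, Fin.sum_univ_five] at hsum
  have hlast := hX.1.two_le_resCount_last hline hLA hL
  rw [hk] at hlast
  have hfirst : k 0 ≤ nodesOn X (L 0) := by
    rw [← hk]
    exact Set.ncard_le_ncard (fun B hB => ⟨hB.1, hB.2.1⟩) (hX.1.1.inter_of_left _)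
  have hle := hX.nodesOn_le (hline 0)
  have hne := hnm (L 0) (hline 0)
  have h01 := hanti 0 1 (by decide)
  have h12 := hanti 1 2 (by decide)
  have h23 := hanti 2 3 (by decide)
  have h34 := hanti 3 4 (by decide)
  have hk_eq : k = ![k 0, k 1, k 2, k 3, k 4] := by
    ext i
    fin_cases i <;> rfl
  generalize k 0 = a, k 1 = b, k 2 = c', k 3 = d, k 4 = e at *
  have hcases : (a = 5 ∧ b = 5 ∧ c' = 5 ∧ d = 3 ∧ e = 2) ∨
      (a = 5 ∧ b = 5 ∧ c' = 4 ∧ d = 4 ∧ e = 2) ∨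
      (a = 5 ∧ b = 5 ∧ c' = 4 ∧ d = 3 ∧ e = 3) ∨ (a = 5 ∧ b = 4 ∧ c' = 4 ∧ d = 4 ∧ e = 3) ∨
      (a = 4 ∧ b = 4 ∧ c' = 4 ∧ d = 4 ∧ e = 4) := by
    clear hk_eq hanti hk hmax
    have ha : a ≤ 5 := by omega
    clear hfirst hle hne
    interval_cases a <;> interval_cases b <;> omega
  rcases hcases with ⟨rfl, rfl, rfl, rfl, rfl⟩ | ⟨rfl, rfl, rfl, rfl, rfl⟩ |
    ⟨rfl, rfl, rfl, rfl, rfl⟩ | ⟨rfl, rfl, rfl, rfl, rfl⟩ | ⟨rfl, rfl, rfl, rfl, rfl⟩ <;>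
    simp only [hk_eq, true_or, or_true]
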